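/- arXiv:2302.00050 — 2 statements merged into one kernel-verified Lean document; each statement's English description precedes it below -/
import Mathlib

section
/- In the category Top of topological spaces, a space X is finitely generated with respect to embeddings if and only if its underlying set is finite. -/
open CategoryTheory CategoryTheory.Limits

universe u

/-- A topological space `X` is finitely generated with respect to embeddings in `Top`
if for every diagram indexed by a directed poset (every finite subset has an upper bound)
whose connecting maps are subspace embeddings, with colimit cocone `c`, every continuous
map `f : X → c.pt` factors through some colimit injection, essentially uniquely (any two
factorizations through the same stage are merged by a connecting map). -/
def TopCat.FinGenWrtEmbeddings (X : TopCat.{u}) : Prop :=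
  ∀ (I : Type u) [PartialOrder I] [Nonempty I] [IsDirected I (· ≤ ·)]
    (F : I ⥤ TopCat.{u}),
    (∀ {i j : I} (f : i ⟶ j), Topology.IsEmbedding (F.map f)) →
    ∀ (c : Cocone F), IsColimit c →
      ∀ f : X ⟶ c.pt,
        (∃ (i : I) (g : X ⟶ F.obj i), g ≫ c.ι.app i = f) ∧
        (∀ (i : I) (g g' : X ⟶ F.obj i), g ≫ c.ι.app i = f → g' ≫ c.ι.app i = f →
          ∃ (j : I) (h : i ≤ j), g ≫ F.map (homOfLE h) = g' ≫ F.map (homOfLE h))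

section aux

variable {I : Type u} [PartialOrder I] [Nonempty I] [IsDirected I (· ≤ ·)]
  {F : I ⥤ TopCat.{u}}

/-- Colimit injections of a directed diagram of embeddings are injective. -/
lemma TopCat.aux_injective
    (hF : ∀ {i j : I} (f : i ⟶ j), Topology.IsEmbedding (F.map f))
    (c : Cocone F) (hc : IsColimit c) (i : I) : Function.Injective (c.ι.app i) := by
  intro x y hxy
  obtain ⟨k, f, g, h⟩ := Concrete.isColimit_exists_of_rep_eq F hc x y hxy
  have : f = g := Subsingleton.elim _ _
  subst this
  exact (hF f).injective h

lemma TopCat.aux_w (c : Cocone F) {i j : I} (f : i ⟶ j) (x : F.obj i) :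
    c.ι.app j (F.map f x) = c.ι.app i x :=
  ConcreteCategory.congr_hom (c.w f) x

lemma TopCat.aux_comp {i j k : I} (f : i ⟶ j) (g : j ⟶ k) (h : i ⟶ k) (x : F.obj i) :
    F.map g (F.map f x) = F.map h x := by
  have : h = f ≫ g := Subsingleton.elim _ _
  subst this
  exact (ConcreteCategory.congr_hom (F.map_comp f g) x).symm

/-- Colimit injections of a directed diagram of embeddings are embeddings. -/
lemma TopCat.aux_closed
    (hF : ∀ {i j : I} (f : i ⟶ j), Topology.IsEmbedding (F.map f))
    (c : Cocone F) (hc : IsColimit c) (i : I) (K : Set (F.obj i)) (hK : IsClosed K) :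
    ∃ C : Set c.pt, IsClosed C ∧ c.ι.app i ⁻¹' C = K := by
  let C : Set c.pt := {z | ∃ (j : I) (h : i ⟶ j) (w : F.obj j),
    w ∈ closure (F.map h '' K) ∧ c.ι.app j w = z}
  have key : ∀ (l : I) (h : i ⟶ l), c.ι.app l ⁻¹' C = closure (F.map h '' K) := by
    intro l h
    ext v
    constructor
    · rintro ⟨j, h', w, hw, hwv⟩
      obtain ⟨m, f, g, hm⟩ := Concrete.isColimit_exists_of_rep_eq F hc w v hwv
      rw [(hF g).isInducing.closure_eq_preimage_closure_image]
      change F.map g v ∈ closure (F.map g '' (F.map h '' K))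
      rw [← hm]
      have h1 : F.map f w ∈ closure (F.map f '' (F.map h' '' K)) :=
        image_closure_subset_closure_image (hF f).continuous ⟨w, hw, rfl⟩
      have h2 : F.map f '' (F.map h' '' K) = F.map g '' (F.map h '' K) := by
        rw [Set.image_image, Set.image_image]
        refine Set.image_congr fun x _ => ?_
        rw [TopCat.aux_comp h' f (h' ≫ f), TopCat.aux_comp h g (h' ≫ f)]
      rwa [h2] at h1
    · intro hv
      exact ⟨l, h, v, hv, rfl⟩
  refine ⟨C, ?_, ?_⟩
  · rw [TopCat.isClosed_iff_of_isColimit c hc]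
    intro k
    obtain ⟨l, hil, hkl⟩ := exists_ge_ge i k
    have : c.ι.app k ⁻¹' C = F.map (homOfLE hkl) ⁻¹' (c.ι.app l ⁻¹' C) := by
      ext x
      change c.ι.app k x ∈ C ↔ c.ι.app l (F.map (homOfLE hkl) x) ∈ C
      rw [TopCat.aux_w]
    rw [this, key l (homOfLE hil)]
    exact isClosed_closure.preimage (hF _).continuous
  · rw [key i (𝟙 i)]
    have : F.map (𝟙 i) '' K = K := by
      rw [F.map_id]
      simp
    rw [this, hK.closure_eq]

lemma TopCat.aux_isInducing
    (hF : ∀ {i j : I} (f : i ⟶ j), Topology.IsEmbedding (F.map f))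
    (c : Cocone F) (hc : IsColimit c) (i : I) : Topology.IsInducing (c.ι.app i) := by
  rw [Topology.isInducing_iff]
  refine le_antisymm (continuous_iff_le_induced.mp (c.ι.app i).hom.continuous) ?_
  intro U hU
  obtain ⟨C, hC, hCU⟩ := TopCat.aux_closed hF c hc i Uᶜ (isClosed_compl_iff.mpr hU)
  refine ⟨Cᶜ, hC.isOpen_compl, ?_⟩
  rw [Set.preimage_compl, hCU, compl_compl]

end aux

/-- The finite subsets of `X`, with the indiscrete topologies. -/
def TopCat.auxFunctor (X : Type u) : Finset X ⥤ TopCat.{u} where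
  obj s := @TopCat.of {x : X // x ∈ s} ⊤
  map {s t} f := @TopCat.ofHom _ _ ⊤ ⊤
    (@ContinuousMap.mk _ _ ⊤ ⊤ (fun x => ⟨x.1, leOfHom f x.2⟩) continuous_top)

/-- The cocone over `auxFunctor`. -/
def TopCat.auxCocone (X : Type u) : Cocone (TopCat.auxFunctor X) where
  pt := @TopCat.of X ⊤
  ι := { app := fun s => @TopCat.ofHom _ _ ⊤ ⊤
          (@ContinuousMap.mk _ _ ⊤ ⊤ (fun x => x.1) continuous_top) }

lemma TopCat.auxCocone_desc_continuous (X : Type u) (s : Cocone (TopCat.auxFunctor X)) :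
    @Continuous X s.pt ⊤ _ (fun x => s.ι.app {x} ⟨x, Finset.mem_singleton_self x⟩) := by
  classical
  letI : TopologicalSpace X := ⊤
  have hsub : ∀ (x : X) (t : Finset X) (hx : x ∈ t),
      s.ι.app {x} ⟨x, Finset.mem_singleton_self x⟩ = s.ι.app t ⟨x, hx⟩ := by
    intro x t hx
    exact (TopCat.aux_w s (homOfLE (Finset.singleton_subset_iff.mpr hx))
      ⟨x, Finset.mem_singleton_self x⟩).symm
  refine continuous_def.mpr fun V hV => ?_
  rw [TopologicalSpace.isOpen_top_iff]
  rw [or_iff_not_imp_left]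
  intro hne
  obtain ⟨x, hx⟩ := Set.nonempty_iff_ne_empty.mpr hne
  refine Set.eq_univ_of_forall fun y => ?_
  have ho := hV.preimage (s.ι.app ({x, y} : Finset X)).hom.continuous
  rcases (TopologicalSpace.isOpen_top_iff _).mp ho with h | h
  · exfalso
    have h1 := Set.eq_empty_iff_forall_notMem.mp h ⟨x, by simp⟩
    apply h1
    change s.ι.app {x, y} _ ∈ V
    rw [← hsub x]
    exact hx
  · have h1 := Set.eq_univ_iff_forall.mp h ⟨y, by simp⟩
    change s.ι.app {x, y} _ ∈ V at h1
    rw [← hsub y] at h1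
    exact h1

/-- The cocone is a colimit. -/
noncomputable def TopCat.auxIsColimit (X : Type u) : IsColimit (TopCat.auxCocone X) where
  desc s := @TopCat.ofHom _ _ ⊤ _
    (@ContinuousMap.mk _ _ ⊤ _ (fun x => s.ι.app {x} ⟨x, Finset.mem_singleton_self x⟩)
      (TopCat.auxCocone_desc_continuous X s))
  fac s t := by
    ext ⟨x, hx⟩
    exact (TopCat.aux_w s (homOfLE (Finset.singleton_subset_iff.mpr hx))
      ⟨x, Finset.mem_singleton_self x⟩).symm
  uniq s m hm := by
    ext x
    exact ConcreteCategory.congr_hom (hm {x}) ⟨x, Finset.mem_singleton_self x⟩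

lemma TopCat.auxFunctor_isEmbedding (X : Type u) {s t : Finset X} (f : s ⟶ t) :
    Topology.IsEmbedding ((TopCat.auxFunctor X).map f) := by
  refine ⟨⟨?_⟩, ?_⟩
  · exact induced_top.symm
  · intro x y h
    exact Subtype.ext (congrArg (fun z : {x : X // x ∈ t} => z.1) h)

/-- In `Top`, a space is finitely generated with respect to embeddings
if and only if its underlying set is finite. -/
theorem TopCat.finGenWrtEmbeddings_iff_finite (X : TopCat.{u}) :
    TopCat.FinGenWrtEmbeddings X ↔ Finite X := by
  constructor
  · intro h
    classical
    let f : X ⟶ (TopCat.auxCocone X).pt := @TopCat.ofHom _ _ _ ⊤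
      (@ContinuousMap.mk _ _ _ ⊤ (fun x => x) continuous_top)
    obtain ⟨⟨s, g, hg⟩, -⟩ := h (Finset X) (TopCat.auxFunctor X)
      (TopCat.auxFunctor_isEmbedding X) _ (TopCat.auxIsColimit X) f
    have hmem : ∀ x : X, x ∈ s := by
      intro x
      have h1 : (g x : {x : X // x ∈ s}).1 = x := ConcreteCategory.congr_hom hg x
      rw [← h1]
      exact (g x : {x : X // x ∈ s}).2
    exact Set.finite_univ_iff.mp (s.finite_toSet.subset fun x _ => hmem x)
  · intro hX I _ _ _ F hF c hc f
    refine ⟨?_, ?_⟩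
    · choose j y hy using fun x : X => Concrete.isColimit_exists_rep F hc (f x)
      obtain ⟨i, hi⟩ := Finite.exists_le j
      let g : X → F.obj i := fun x => F.map (homOfLE (hi x)) (y x)
      have hg : ∀ x, c.ι.app i (g x) = f x := fun x => by
        rw [TopCat.aux_w, hy]
      have hgc : Continuous g := by
        rw [(TopCat.aux_isInducing hF c hc i).continuous_iff]
        exact f.hom.continuous.congr fun x => (hg x).symm
      refine ⟨i, TopCat.ofHom ⟨g, hgc⟩, ?_⟩
      ext x
      exact hg x
    · intro i g g' h h'
      refine ⟨i, le_rfl, ?_⟩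
      have : g = g' := by
        ext x
        apply TopCat.aux_injective hF c hc i
        exact ConcreteCategory.congr_hom (h.trans h'.symm) x
      rw [this]
end

section
/- There exists a topological space X together with an increasing sequence X₀ ⊆ X₁ ⊆ X₂ ⊆ … of subsets with X = ⋃_{m<ω} X_m such that: each X_m is closed in X; each X_m, with the subspace topology, is a Tychonoff space (completely regular and T₁); X carries the final topology with respect to the inclusions X_m → X (a set U ⊆ X is open if and only if U ∩ X_m is open in X_m for every m); and X is a T₁-space but is not Hausdorff. -/
open Set Filter Topology Cardinal TopologicalSpace

namespace Herrlich

/-- A type synonym for the Cantor tree together with its branches. -/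
def Psi : Type := List Bool ⊕ (ℕ → Bool)

/-- The node of level `n` on the branch `x`. -/
def node (x : ℕ → Bool) (n : ℕ) : Psi := Sum.inl (List.ofFn fun i : Fin n => x i)

/-- The branch `x` as a point. -/
def br (x : ℕ → Bool) : Psi := Sum.inr x

instance : TopologicalSpace Psi where
  IsOpen U := ∀ x, br x ∈ U → ∀ᶠ n in atTop, node x n ∈ U
  isOpen_univ := by intro x _; simp
  isOpen_inter := by
    intro s t hs ht x hx
    exact (hs x hx.1).and (ht x hx.2)
  isOpen_sUnion := by
    intro S hS x hx
    obtain ⟨s, hs, hxs⟩ := hx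
    exact (hS s hs x hxs).mono fun n hn => ⟨s, hs, hn⟩

theorem psi_isOpen {U : Set Psi} :
    IsOpen U ↔ ∀ x, br x ∈ U → ∀ᶠ n in atTop, node x n ∈ U := Iff.rfl

theorem node_inj {x y : ℕ → Bool} {n k : ℕ} (h : node x n = node y k) :
    n = k ∧ ∀ i < n, x i = y i := by
  have h' : (List.ofFn fun i : Fin n => x i) = List.ofFn fun i : Fin k => y i :=
    Sum.inl.inj h
  have hl : n = k := by simpa using congrArg List.length h'
  subst hl
  refine ⟨rfl, fun i hi => ?_⟩
  have := congrFun (List.ofFn_injective h') ⟨i, hi⟩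
  exact this

theorem br_ne_inl (x : ℕ → Bool) (l : List Bool) : br x ≠ Sum.inl l := by
  intro h; cases h

theorem isClopen_inl (l : List Bool) : IsClopen ({Sum.inl l} : Set Psi) := by
  constructor
  · rw [← isOpen_compl_iff, psi_isOpen]
    intro x _
    filter_upwards [eventually_gt_atTop l.length] with n hn h
    have h' : (List.ofFn fun i : Fin n => x i) = l := Sum.inl.inj h
    have := congrArg List.length h'
    simp at this
    omega
  · rw [psi_isOpen]
    intro x hx
    exact absurd hx (br_ne_inl x l)

/-- Basic neighbourhoods of a branch. -/
def nb (x : ℕ → Bool) (N : ℕ) : Set Psi := {z | z = br x ∨ ∃ n ≥ N, z = node x n}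

theorem br_mem_nb {x y : ℕ → Bool} {N : ℕ} : br y ∈ nb x N ↔ y = x := by
  constructor
  · rintro (h | ⟨n, _, h⟩)
    · exact Sum.inr.inj h
    · exact absurd h (br_ne_inl _ _)
  · rintro rfl
    exact Or.inl rfl

theorem isClopen_nb (x : ℕ → Bool) (N : ℕ) : IsClopen (nb x N) := by
  constructor
  · rw [← isOpen_compl_iff, psi_isOpen]
    intro y hy
    have hne : y ≠ x := fun h => hy (br_mem_nb.2 h)
    obtain ⟨i, hi⟩ := Function.ne_iff.1 hne
    filter_upwards [eventually_gt_atTop i] with n hn h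
    rcases h with h | ⟨k, _, h⟩
    · exact br_ne_inl _ _ h.symm
    · exact hi ((node_inj h).2 i hn)
  · rw [psi_isOpen]
    intro y hy
    obtain rfl := br_mem_nb.1 hy
    filter_upwards [eventually_ge_atTop N] with n hn
    exact Or.inr ⟨n, hn, rfl⟩

theorem psi_clopen (z : Psi) (U : Set Psi) (hU : IsOpen U) (hz : z ∈ U) :
    ∃ C, IsClopen C ∧ z ∈ C ∧ C ⊆ U := by
  rcases z with l | x
  · exact ⟨{Sum.inl l}, isClopen_inl l, rfl, by rintro _ rfl; exact hz⟩
  · obtain ⟨N, hN⟩ := eventually_atTop.1 (psi_isOpen.1 hU x hz)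
    refine ⟨nb x N, isClopen_nb x N, Or.inl rfl, ?_⟩
    rintro _ (rfl | ⟨n, hn, rfl⟩)
    · exact hz
    · exact hN n hn

instance psi_t1 : T1Space Psi where
  t1 := by
    rintro (l | x)
    · exact (isClopen_inl l).1
    · rw [← isOpen_compl_iff, psi_isOpen]
      intro y _
      exact Eventually.of_forall fun n h => br_ne_inl _ _ h.symm

theorem psi_not_normal : ¬ NormalSpace Psi := by
  have hsep : SeparableSpace Psi := by
    refine ⟨⟨range (Sum.inl : List Bool → Psi), countable_range _, ?_⟩⟩
    intro z
    rw [mem_closure_iff]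
    rintro U hU hz
    rcases z with l | x
    · exact ⟨_, hz, l, rfl⟩
    · obtain ⟨n, hn⟩ := (psi_isOpen.1 hU x hz).exists
      exact ⟨_, hn, _, rfl⟩
  have hcl : IsClosed (range br) := by
    rw [← isOpen_compl_iff, psi_isOpen]
    intro y hy
    exact absurd ⟨y, rfl⟩ hy
  have hd : DiscreteTopology (range br) := by
    rw [discreteTopology_subtype_iff']
    rintro _ ⟨x, rfl⟩
    refine ⟨nb x 0, (isClopen_nb x 0).2, ?_⟩
    ext z
    constructor
    · rintro ⟨h, y, rfl⟩
      rw [br_mem_nb.1 h]; rfl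
    · rintro rfl
      exact ⟨Or.inl rfl, x, rfl⟩
  refine hcl.not_normal_of_continuum_le_mk ?_
  rw [mk_range_eq br (fun a b h => Sum.inr.inj h)]
  simp

/-- The Herrlich space over `Y` with two subsets `H true`, `H false`. -/
def Space (Y : Type) (_H : Bool → Set Y) : Type := Bool ⊕ (ℕ × Y)

variable {Y : Type} [TopologicalSpace Y] {H : Bool → Set Y}

/-- The limit points. -/
def pt (H : Bool → Set Y) (b : Bool) : Space Y H := Sum.inl b

/-- The points of the copies of `Y`. -/
def cp (H : Bool → Set Y) (n : ℕ) (y : Y) : Space Y H := Sum.inr (n, y)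

instance : TopologicalSpace (Space Y H) where
  IsOpen U := (∀ n, IsOpen {y | cp H n y ∈ U}) ∧
    ∀ b, pt H b ∈ U → ∀ᶠ n in atTop, ∀ y ∈ H b, cp H n y ∈ U
  isOpen_univ := by simp
  isOpen_inter := by
    intro s t hs ht
    refine ⟨fun n => (hs.1 n).inter (ht.1 n), fun b hb => ?_⟩
    filter_upwards [hs.2 b hb.1, ht.2 b hb.2] with n h1 h2 y hy
    exact ⟨h1 y hy, h2 y hy⟩
  isOpen_sUnion := by
    intro S hS
    refine ⟨fun n => ?_, ?_⟩
    · have : {y | cp H n y ∈ ⋃₀ S} = ⋃ s ∈ S, {y | cp H n y ∈ s} := by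
        ext y; simp
      rw [this]
      exact isOpen_biUnion fun s hs => (hS s hs).1 n
    · rintro b ⟨s, hs, hb⟩
      exact ((hS s hs).2 b hb).mono fun n hn y hy => ⟨s, hs, hn y hy⟩

theorem sp_isOpen {U : Set (Space Y H)} :
    IsOpen U ↔ (∀ n, IsOpen {y | cp H n y ∈ U}) ∧
    ∀ b, pt H b ∈ U → ∀ᶠ n in atTop, ∀ y ∈ H b, cp H n y ∈ U := Iff.rfl

/-- The set with prescribed limit points and prescribed slices. -/
def mkSet (H : Bool → Set Y) (P : Set Bool) (S : ℕ → Set Y) : Set (Space Y H) :=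
  fun z => Sum.elim (fun b => b ∈ P) (fun q => q.2 ∈ S q.1) z

@[simp] theorem pt_mem {P : Set Bool} {S : ℕ → Set Y} {b : Bool} :
    pt H b ∈ mkSet H P S ↔ b ∈ P := Iff.rfl

@[simp] theorem cp_mem {P : Set Bool} {S : ℕ → Set Y} {n : ℕ} {y : Y} :
    cp H n y ∈ mkSet H P S ↔ y ∈ S n := Iff.rfl

theorem compl_mkSet {P : Set Bool} {S : ℕ → Set Y} :
    (mkSet H P S)ᶜ = mkSet H Pᶜ (fun n => (S n)ᶜ) := by
  ext z
  rcases z with b | ⟨n, y⟩ <;> rfl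

theorem isOpen_mkSet {P : Set Bool} {S : ℕ → Set Y} (hS : ∀ n, IsOpen (S n))
    (hP : ∀ b ∈ P, ∀ᶠ n in atTop, H b ⊆ S n) : IsOpen (mkSet H P S) :=
  sp_isOpen.2 ⟨hS, hP⟩

theorem isClosed_mkSet {P : Set Bool} {S : ℕ → Set Y} (hS : ∀ n, IsClosed (S n))
    (hP : ∀ b ∉ P, ∀ᶠ n in atTop, H b ⊆ (S n)ᶜ) : IsClosed (mkSet H P S) := by
  rw [← isOpen_compl_iff, compl_mkSet]
  exact isOpen_mkSet (fun n => (hS n).isOpen_compl) hP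

/-- The chain of closed subsets. -/
def A (H : Bool → Set Y) (m : ℕ) : Set (Space Y H) :=
  mkSet H univ (fun n => {y | n < m ∨ ∃ b, y ∈ H b})

theorem isClosed_A (hc : ∀ b, IsClosed (H b)) (m : ℕ) : IsClosed (A H m) := by
  refine isClosed_mkSet (fun n => ?_) (fun b hb => absurd (mem_univ b) hb)
  by_cases h : n < m
  · simp [h]
  · have : {y | n < m ∨ ∃ b, y ∈ H b} = H true ∪ H false := by
      ext y; simp [h, or_comm]
    rw [this]
    exact (hc _).union (hc _)

theorem sp_t1 [T1Space Y] : T1Space (Space Y H) where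
  t1 := by
    rintro (b | ⟨n, y⟩)
    · have : ({pt H b} : Set (Space Y H)) = mkSet H {b} (fun _ => ∅) := by
        ext z
        rcases z with c | ⟨n, y⟩
        · exact ⟨fun h => Sum.inl.inj h, fun h => congrArg Sum.inl h⟩
        · exact ⟨fun h => (by cases h), fun h => False.elim h⟩
      change IsClosed ({pt H b} : Set (Space Y H))
      rw [this]
      exact isClosed_mkSet (fun _ => isClosed_empty) (by simp)
    · have : ({cp H n y} : Set (Space Y H)) =
          mkSet H ∅ (fun k => {w | k = n ∧ w = y}) := by
        ext z
        rcases z with c | ⟨k, w⟩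
        · exact ⟨fun h => (by cases h), fun h => False.elim h⟩
        · exact ⟨fun h => Prod.mk.inj (Sum.inr.inj h),
            fun h => congrArg Sum.inr (Prod.ext h.1 h.2)⟩
      change IsClosed ({cp H n y} : Set (Space Y H))
      rw [this]
      refine isClosed_mkSet (fun k => ?_) (fun b _ => ?_)
      · by_cases h : k = n
        · simp [h]
        · simp [h]
      · filter_upwards [eventually_gt_atTop n] with k hk w _ h
        exact absurd h.1 hk.ne'

theorem sp_clopen (hc : ∀ b, IsClosed (H b)) (hd : Disjoint (H true) (H false))
    (hY : ∀ (z : Y) (U : Set Y), IsOpen U → z ∈ U → ∃ C, IsClopen C ∧ z ∈ C ∧ C ⊆ U)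
    (m : ℕ) (z : Space Y H) (U : Set (Space Y H)) (hU : IsOpen U) (hz : z ∈ U) :
    ∃ O K : Set (Space Y H), IsOpen O ∧ IsClosed K ∧ O ∩ A H m = K ∩ A H m ∧
      z ∈ K ∧ K ⊆ U := by
  have hd' : ∀ b y, y ∈ H b → y ∉ H (!b) := by
    intro b y h1 h2
    cases b
    · exact disjoint_left.1 hd h2 h1
    · exact disjoint_left.1 hd h1 h2
  rcases z with b | ⟨n, y⟩
  · obtain ⟨N₀, hN₀⟩ := eventually_atTop.1 ((sp_isOpen.1 hU).2 b hz)
    obtain ⟨N, hN, hNm⟩ : ∃ N, N₀ ≤ N ∧ m ≤ N := ⟨max N₀ m, by simp, by simp⟩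
    refine ⟨mkSet H {b} (fun n => {y | N ≤ n ∧ y ∉ H (!b)}),
      mkSet H {b} (fun n => {y | N ≤ n ∧ y ∈ H b}), ?_, ?_, ?_, ?_, ?_⟩
    · refine isOpen_mkSet (fun n => ?_) ?_
      · by_cases h : N ≤ n
        · simp only [h, true_and]
          exact (hc (!b)).isOpen_compl
        · simp [h]
      · rintro _ rfl
        filter_upwards [eventually_ge_atTop N] with n hn y hy
        exact ⟨hn, hd' _ y hy⟩
    · refine isClosed_mkSet (fun n => ?_) ?_
      · by_cases h : N ≤ n
        · simpa [h] using hc b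
        · simp [h]
      · intro c hcb
        refine Eventually.of_forall fun n y hy h => ?_
        have : c = !b := by cases b <;> cases c <;> simp_all
        subst this
        exact hd' _ y h.2 hy
    · ext z
      rcases z with c | ⟨n, y⟩
      · exact Iff.rfl
      · change ((N ≤ n ∧ y ∉ H (!b)) ∧ (n < m ∨ ∃ b, y ∈ H b)) ↔
          ((N ≤ n ∧ y ∈ H b) ∧ (n < m ∨ ∃ b, y ∈ H b))
        constructor
        · rintro ⟨⟨h1, h2⟩, h3⟩
          refine ⟨⟨h1, ?_⟩, h3⟩
          rcases h3 with h3 | ⟨c, h3⟩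
          · omega
          · cases b <;> cases c <;> simp_all
        · rintro ⟨⟨h1, h2⟩, h3⟩
          exact ⟨⟨h1, hd' _ _ h2⟩, h3⟩
    · exact rfl
    · rintro (c | ⟨n, y⟩) h
      · obtain rfl : c = b := h
        exact hz
      · exact hN₀ n (hN.trans h.1) y h.2
  · obtain ⟨C, hC, hyC, hCU⟩ := hY y _ ((sp_isOpen.1 hU).1 n) hz
    refine ⟨mkSet H ∅ (fun k => {w | k = n ∧ w ∈ C}),
      mkSet H ∅ (fun k => {w | k = n ∧ w ∈ C}), ?_, ?_, rfl, ⟨rfl, hyC⟩, ?_⟩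
    · refine isOpen_mkSet (fun k => ?_) (by simp)
      by_cases h : k = n
      · simpa [h] using hC.2
      · simp [h]
    · refine isClosed_mkSet (fun k => ?_) (fun b _ => ?_)
      · by_cases h : k = n
        · simpa [h] using hC.1
        · simp [h]
      · filter_upwards [eventually_gt_atTop n] with k hk w _ h
        exact absurd h.1 hk.ne'
    · rintro (c | ⟨k, w⟩) h
      · exact h.elim
      · obtain ⟨rfl, hw⟩ := h
        exact hCU hw

theorem A_cr (hc : ∀ b, IsClosed (H b)) (hd : Disjoint (H true) (H false))
    (hY : ∀ (z : Y) (U : Set Y), IsOpen U → z ∈ U → ∃ C, IsClopen C ∧ z ∈ C ∧ C ⊆ U)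
    (m : ℕ) : CompletelyRegularSpace (A H m) := by
  apply CompletelyRegularSpace.of_isTopologicalBasis_clopens
  refine isTopologicalBasis_of_isOpen_of_nhds (fun s hs => hs.2) ?_
  rintro ⟨z, hzA⟩ V hz hV
  obtain ⟨U, hU, rfl⟩ := isOpen_induced_iff.1 hV
  obtain ⟨O, K, hO, hK, hOK, hzK, hKU⟩ := sp_clopen hc hd hY m z U hU hz
  refine ⟨Subtype.val ⁻¹' K, ⟨hK.preimage continuous_subtype_val, ?_⟩, hzK,
    preimage_mono hKU⟩
  have : (Subtype.val ⁻¹' K : Set (A H m)) = Subtype.val ⁻¹' O := by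
    ext ⟨w, hw⟩
    have := Set.ext_iff.1 hOK w
    simp only [mem_inter_iff, hw, and_true] at this
    exact this.symm
  rw [this]
  exact hO.preimage continuous_subtype_val

theorem final (U : Set (Space Y H)) (h : ∀ m, IsOpen (((↑) : A H m → Space Y H) ⁻¹' U)) :
    IsOpen U := by
  have h' : ∀ m, ∃ O, IsOpen O ∧ ∀ z ∈ A H m, (z ∈ O ↔ z ∈ U) := by
    intro m
    obtain ⟨O, hO, hOU⟩ := isOpen_induced_iff.1 (h m)
    exact ⟨O, hO, fun z hz => Set.ext_iff.1 hOU ⟨z, hz⟩⟩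
  rw [sp_isOpen]
  constructor
  · intro n
    obtain ⟨O, hO, hOU⟩ := h' (n + 1)
    have : {y | cp H n y ∈ U} = {y | cp H n y ∈ O} := by
      ext y
      exact (hOU _ (Or.inl (Nat.lt_succ_self n))).symm
    rw [this]
    exact (sp_isOpen.1 hO).1 n
  · intro b hb
    obtain ⟨O, hO, hOU⟩ := h' 0
    have hbO : pt H b ∈ O := (hOU _ (mem_univ b)).2 hb
    filter_upwards [(sp_isOpen.1 hO).2 b hbO] with n hn y hy
    exact (hOU _ (Or.inr ⟨b, hy⟩)).1 (hn y hy)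

theorem not_t2 (hs : ¬ SeparatedNhds (H true) (H false)) : ¬ T2Space (Space Y H) := by
  intro hT
  have hne : pt H true ≠ pt H false := by intro h; cases h
  obtain ⟨U, V, hU, hV, hpU, hqV, hUV⟩ := t2_separation hne
  obtain ⟨n, h1, h2⟩ :=
    (((sp_isOpen.1 hU).2 _ hpU).and ((sp_isOpen.1 hV).2 _ hqV)).exists
  refine hs ⟨_, _, (sp_isOpen.1 hU).1 n, (sp_isOpen.1 hV).1 n, h1, h2, ?_⟩
  rw [disjoint_left]
  intro y hy hy'
  exact disjoint_left.1 hUV hy hy'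

end Herrlich

/-- Herrlich's example. There exists a topological space `X` together with
an increasing sequence of subsets `A 0 ⊆ A 1 ⊆ …` covering `X` such that each `A m` is closed
in `X`, each `A m` with the subspace topology is a Tychonoff space (completely regular and T₁),
`X` carries the final topology with respect to the inclusions (a set is open iff its trace on
every `A m` is open), and `X` is T₁ but not Hausdorff. -/
theorem exists_T1_nonHausdorff_colimit_of_closed_tychonoff_chain :
    ∃ (X : Type) (_ : TopologicalSpace X) (A : ℕ → Set X),
      (∀ m, A m ⊆ A (m + 1)) ∧
      (⋃ m, A m) = Set.univ ∧
      (∀ m, IsClosed (A m)) ∧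
      (∀ m, CompletelyRegularSpace (A m) ∧ T1Space (A m)) ∧
      (∀ U : Set X, IsOpen U ↔ ∀ m, IsOpen (((↑) : A m → X) ⁻¹' U)) ∧
      T1Space X ∧ ¬ T2Space X := by
  classical
  obtain ⟨F, G, hF, hG, hFG, hs⟩ : ∃ F G : Set Herrlich.Psi, IsClosed F ∧ IsClosed G ∧
      Disjoint F G ∧ ¬ SeparatedNhds F G := by
    by_contra hcon
    push Not at hcon
    exact Herrlich.psi_not_normal ⟨hcon⟩
  let H : Bool → Set Herrlich.Psi := fun b => if b then F else G
  have hc : ∀ b, IsClosed (H b) := by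
    intro b
    cases b
    · exact hG
    · exact hF
  have hT : T1Space (Herrlich.Space Herrlich.Psi H) := Herrlich.sp_t1
  refine ⟨Herrlich.Space Herrlich.Psi H, inferInstance, Herrlich.A H, ?_, ?_,
    Herrlich.isClosed_A hc,
    fun m => ⟨Herrlich.A_cr hc hFG Herrlich.psi_clopen m, inferInstance⟩, ?_, hT,
    Herrlich.not_t2 hs⟩
  · rintro m (b | ⟨n, y⟩) h
    · trivial
    · exact Or.imp_left (fun h : n < m => Nat.lt_succ_of_lt h) h
  · refine Set.eq_univ_of_forall ?_
    rintro (b | ⟨n, y⟩)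
    · exact Set.mem_iUnion.2 ⟨0, trivial⟩
    · exact Set.mem_iUnion.2 ⟨n + 1, Or.inl (Nat.lt_succ_self n)⟩
  · intro U
    exact ⟨fun hU m => hU.preimage continuous_subtype_val, Herrlich.final U⟩
end
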